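/- Let d ≥ 3, ζ₁, ζ₂ ∈ ℂ^d with ζ₁·ζ₁ = ζ₂·ζ₂ = 0, and let I_k = ∫_{S^{d-1}} (ζ₁·x)^k (ζ₂·x)^k dS(x). Then for all k ≥ 1 the recurrence I_k = (ζ₁·ζ₂)·(k/(2k+d-2))·I_{k-1} holds. -/

import Mathlib

open MeasureTheory

/-- The Euclidean unit sphere of `ℝⁿ⁺¹` has finite `n`-dimensional Hausdorff measure. -/
theorem hausdorffMeasure_sphere_lt_top (n : ℕ) :
    μH[(n : ℝ)] (Metric.sphere (0 : EuclideanSpace ℝ (Fin (n + 1))) 1) < ⊤ := by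
  let G : Fin (n + 1) → ℝ → (Fin n → ℝ) → EuclideanSpace ℝ (Fin (n + 1)) :=
    fun i c y => WithLp.toLp 2 (i.insertNth c y)
  let F : Fin (n + 1) → ℝ → (Fin n → ℝ) → EuclideanSpace ℝ (Fin (n + 1)) :=
    fun i c y => ‖G i c y‖⁻¹ • G i c y
  have hG (i c) : ContDiff ℝ 1 (G i c) := by
    refine contDiff_piLp' 2 fun j => ?_
    refine Fin.succAboveCases i ?_ (fun j => ?_) j
    · simpa [G] using contDiff_const
    · simpa [G] using contDiff_apply ℝ ℝ j
  have hG0 (i) {c : ℝ} (hc : c ≠ 0) (y) : G i c y ≠ 0 := fun h => hc <| by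
    simpa [G] using congrArg (fun z : EuclideanSpace ℝ (Fin (n + 1)) => z i) h
  have hF (i) {c : ℝ} (hc : c ≠ 0) :
      μH[(n : ℝ)] (F i c '' Set.Icc (fun _ => -1) (fun _ => 1)) < ⊤ := by
    have hs : ContDiff ℝ 1 (F i c) :=
      (((hG i c).norm ℝ (hG0 i hc)).inv fun y => norm_ne_zero_iff.2 (hG0 i hc y)).smul (hG i c)
    obtain ⟨K, hK⟩ := hs.locallyLipschitz.locallyLipschitzOn.exists_lipschitzOnWith_of_compact
      (isCompact_Icc (a := fun _ : Fin n => (-1 : ℝ)) (b := fun _ => 1))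
    refine (hK.hausdorffMeasure_image_le n.cast_nonneg).trans_lt ?_
    refine ENNReal.mul_lt_top (ENNReal.rpow_lt_top_of_nonneg n.cast_nonneg ENNReal.coe_ne_top) ?_
    have : (μH[(n : ℝ)] : Measure (Fin n → ℝ)) = volume := by
      simpa using hausdorffMeasure_pi_real (ι := Fin n)
    rw [this]
    exact isCompact_Icc.measure_lt_top
  have hsub : Metric.sphere (0 : EuclideanSpace ℝ (Fin (n + 1))) 1 ⊆
      ⋃ i, (F i 1 '' Set.Icc (fun _ => -1) (fun _ => 1) ∪
        F i (-1) '' Set.Icc (fun _ => -1) (fun _ => 1)) := by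
    intro x hx
    rw [mem_sphere_zero_iff_norm] at hx
    obtain ⟨i, hi⟩ := Finite.exists_max fun i => |x i|
    have hxi : 0 < |x i| := by
      by_contra! h
      have : x = 0 := by
        ext j
        exact abs_nonpos_iff.1 ((hi j).trans h)
      simp [this] at hx
    have hy : (fun j => x (i.succAbove j) / |x i|) ∈
        Set.Icc (fun _ : Fin n => (-1 : ℝ)) (fun _ => 1) := by
      rw [Set.mem_Icc, Pi.le_def, Pi.le_def, ← forall_and]
      intro j
      rw [← abs_le, abs_div, abs_abs]
      exact div_le_one_of_le₀ (hi _) hxi.le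
    have hFx : F i (x i / |x i|) (fun j => x (i.succAbove j) / |x i|) = x := by
      have : G i (x i / |x i|) (fun j => x (i.succAbove j) / |x i|) = |x i|⁻¹ • x := by
        ext j
        refine Fin.succAboveCases i ?_ (fun j => ?_) j <;> simp [G, div_eq_inv_mul]
      simp only [F, this, norm_smul, hx, smul_smul]
      simp [hxi.ne']
    refine Set.mem_iUnion.2 ⟨i, ?_⟩
    rcases abs_choice (x i) with h | h
    · refine Or.inl ⟨_, hy, ?_⟩
      rwa [h, div_self (h ▸ hxi.ne'), ← h] at hFx
    · refine Or.inr ⟨_, hy, ?_⟩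
      rwa [div_eq_iff (c := (-1 : ℝ)) hxi.ne' |>.2 (by rw [h]; ring)] at hFx
  refine (measure_mono hsub).trans_lt ?_
  refine (measure_iUnion_fintype_le _ _).trans_lt (ENNReal.sum_lt_top.2 fun i _ => ?_)
  exact measure_union_lt_top (hF i one_ne_zero) (hF i (neg_ne_zero.2 one_ne_zero))

/-- Infinitesimal rotation invariance of the Hausdorff measure on the unit sphere. -/
theorem integral_sphere_fderiv_skewAdjoint_eq_zero {E : Type*} [NormedAddCommGroup E]
    [InnerProductSpace ℝ E] [FiniteDimensional ℝ E] [MeasurableSpace E] [BorelSpace E] {s : ℝ}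
    (hfin : μH[s] (Metric.sphere (0 : E) 1) < ⊤) {A : E →L[ℝ] E} (hA : A ∈ skewAdjoint (E →L[ℝ] E))
    {f : E → ℂ} (hf : ContDiff ℝ 1 f) :
    ∫ x in Metric.sphere (0 : E) 1, fderiv ℝ f x (A x) ∂μH[s] = 0 := by
  have : IsFiniteMeasure ((μH[s] : Measure E).restrict (Metric.sphere 0 1)) :=
    isFiniteMeasure_restrict.2 hfin.ne
  let : NormedAlgebra ℚ (E →L[ℝ] E) := .restrictScalars ℚ ℝ _
  let U : ℝ → unitary (E →L[ℝ] E) := fun t =>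
    ⟨_, NormedSpace.exp_mem_unitary_of_mem_skewAdjoint (skewAdjoint.smul_mem t hA)⟩
  let R : ℝ → E ≃ₗᵢ[ℝ] E := fun t => Unitary.linearIsometryEquiv (U t)
  have hR (t x) : R t x = NormedSpace.exp (t • A) x := rfl
  have hR' (t x) : HasDerivAt (fun t => R t x) (A (R t x)) t :=
    (hasDerivAt_exp_smul_const' (𝕂 := ℝ) A t).clm_apply (hasDerivAt_const t x) |>.congr_deriv
      (by simp [hR])
  have hconst (t) : ∫ x in Metric.sphere (0 : E) 1, f (R t x) ∂μH[s] =
      ∫ x in Metric.sphere (0 : E) 1, f x ∂μH[s] := by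
    have := ((R t).toIsometryEquiv.measurePreserving_hausdorffMeasure s).setIntegral_preimage_emb
      (R t).toHomeomorph.measurableEmbedding f (Metric.sphere 0 1)
    simpa using this
  have hc : Continuous fun x => fderiv ℝ f x (A x) :=
    (hf.continuous_fderiv one_ne_zero).clm_apply A.continuous
  obtain ⟨C, hC⟩ := (isCompact_sphere (0 : E) 1).exists_bound_of_continuousOn hc.continuousOn
  have key := (hasDerivAt_integral_of_dominated_loc_of_deriv_le
    (μ := (μH[s] : Measure E).restrict (Metric.sphere 0 1)) (F := fun t x => f (R t x))
    (F' := fun t x => fderiv ℝ f (R t x) (A (R t x))) (x₀ := (0 : ℝ)) (bound := fun _ => C)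
    Filter.univ_mem
    (.of_forall fun t => (hf.continuous.comp (R t).continuous).aestronglyMeasurable)
    ((hf.continuous.comp (R 0).continuous).continuousOn.integrableOn_of_subset_isCompact
      (isCompact_sphere 0 1) Metric.isClosed_sphere.measurableSet subset_rfl hfin.ne)
    (hc.comp (R 0).continuous).aestronglyMeasurable
    (ae_restrict_of_forall_mem Metric.isClosed_sphere.measurableSet fun x hx t _ =>
      hC _ (by simpa using hx))
    (integrable_const C)
    (.of_forall fun x t _ =>
      ((hf.differentiable one_ne_zero _).hasFDerivAt.comp_hasDerivAt t (hR' t x)))).2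
  simp only [hconst] at key
  simpa [hR] using key.unique (hasDerivAt_const _ _)

/-- Integration by parts on the unit sphere of `ℝᵈ`. -/
theorem integral_sphere_fderiv_single {d : ℕ} {s : ℝ}
    (hfin : μH[s] (Metric.sphere (0 : EuclideanSpace ℝ (Fin d)) 1) < ⊤)
    {g : EuclideanSpace ℝ (Fin d) → ℂ} (hg : ContDiff ℝ 1 g) (i : Fin d) :
    ∫ x in Metric.sphere (0 : EuclideanSpace ℝ (Fin d)) 1,
        fderiv ℝ g x (EuclideanSpace.single i 1) ∂μH[s] =
      ∫ x in Metric.sphere (0 : EuclideanSpace ℝ (Fin d)) 1,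
        (x i : ℂ) * ((d - 1) * g x + fderiv ℝ g x x) ∂μH[s] := by
  have hint {h : EuclideanSpace ℝ (Fin d) → ℂ} (hh : Continuous h) :
      IntegrableOn h (Metric.sphere 0 1) μH[s] :=
    hh.continuousOn.integrableOn_of_subset_isCompact
      (isCompact_sphere 0 1) Metric.isClosed_sphere.measurableSet subset_rfl hfin.ne
  let e : Fin d → EuclideanSpace ℝ (Fin d) := fun j => EuclideanSpace.single j 1
  let A : Fin d → EuclideanSpace ℝ (Fin d) →L[ℝ] EuclideanSpace ℝ (Fin d) := fun j =>
    InnerProductSpace.rankOne ℝ (e j) (e i) - InnerProductSpace.rankOne ℝ (e i) (e j)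
  have hA (j) : A j ∈ skewAdjoint _ := by
    simp [A, skewAdjoint.mem_iff, ContinuousLinearMap.star_eq_adjoint]
  have hAx (j x) : A j x = x i • e j - x j • e i := by
    simp [A, e, EuclideanSpace.inner_single_left]
  have hcoord (j : Fin d) :
      ContDiff ℝ 1 fun x : EuclideanSpace ℝ (Fin d) => (x j : ℂ) :=
    (Complex.ofRealCLM.comp (EuclideanSpace.proj j)).contDiff
  have hf (j) : ContDiff ℝ 1 fun x => (x j : ℂ) * g x := (hcoord j).mul hg
  have hderiv (j x v) : fderiv ℝ (fun x => (x j : ℂ) * g x) x v =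
      (v j : ℂ) * g x + x j * fderiv ℝ g x v := by
    have h1 : HasFDerivAt (fun x : EuclideanSpace ℝ (Fin d) => (x j : ℂ))
        (Complex.ofRealCLM.comp (EuclideanSpace.proj j)) x :=
      (Complex.ofRealCLM.comp (EuclideanSpace.proj j)).hasFDerivAt
    rw [(h1.fun_mul (hg.differentiable one_ne_zero x).hasFDerivAt).fderiv]
    simp
    ring
  have hzero : ∫ x in Metric.sphere (0 : EuclideanSpace ℝ (Fin d)) 1,
      ∑ j, fderiv ℝ (fun x => (x j : ℂ) * g x) x (A j x) ∂μH[s] = 0 := by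
    rw [integral_finsetSum]
    · exact Finset.sum_eq_zero fun j _ =>
        integral_sphere_fderiv_skewAdjoint_eq_zero hfin (hA j) (hf j)
    · exact fun j _ => hint (((hf j).continuous_fderiv one_ne_zero).clm_apply (A j).continuous)
  have hg' := hg.continuous_fderiv one_ne_zero
  rw [eq_comm, ← sub_eq_zero, ← integral_sub, ← hzero]
  · refine setIntegral_congr_fun Metric.isClosed_sphere.measurableSet fun x hx => ?_
    have hnorm : ∑ j, (x j : ℂ) * x j = 1 := by
      rw [mem_sphere_zero_iff_norm] at hx
      have := EuclideanSpace.real_norm_sq_eq x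
      rw [hx] at this
      simp only [← sq]
      exact_mod_cast (by simpa using this.symm)
    have hx' : fderiv ℝ g x x = ∑ j, (x j : ℂ) * fderiv ℝ g x (e j) := by
      have := congrArg (fderiv ℝ g x) ((EuclideanSpace.basisFun (Fin d) ℝ).sum_repr x)
      simpa [e] using this.symm
    have hterm (j) : fderiv ℝ (fun x => (x j : ℂ) * g x) x (A j x) =
        (x i - if j = i then (x i : ℂ) else 0) * g x +
          (x i * (x j * fderiv ℝ g x (e j)) - x j * x j * fderiv ℝ g x (e i)) := by
      rw [hderiv, hAx]
      rcases eq_or_ne j i with rfl | h <;> simp [e, *] <;> ring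
    simp only [hterm, Finset.sum_add_distrib, Finset.sum_sub_distrib, ← Finset.sum_mul,
      ← Finset.mul_sum, ← hx', hnorm]
    simp [e]
    ring
  · exact hint ((hcoord i).continuous.mul
      ((continuous_const.mul hg.continuous).add (hg'.clm_apply continuous_id)))
  · exact hint (hg'.clm_apply continuous_const)

/-- Let `d ≥ 3` and `ζ₁, ζ₂ ∈ ℂ^d` with `ζ₁·ζ₁ = 0 = ζ₂·ζ₂` (bilinear dot product), and let
`I_k = ∫_{S^{d-1}} (ζ₁·x)^k (ζ₂·x)^k dS(x)`. Then for all `k ≥ 1` the recurrence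
`I_k = (ζ₁·ζ₂) (k/(2k+d-2)) I_{k-1}` holds. -/
theorem integral_sphere_pow_recurrence {d : ℕ} (hd : 3 ≤ d) (ζ₁ ζ₂ : Fin d → ℂ)
    (h₁ : ∑ j, ζ₁ j * ζ₁ j = 0) (h₂ : ∑ j, ζ₂ j * ζ₂ j = 0)
    (I : ℕ → ℂ)
    (hI : ∀ k : ℕ, I k = ∫ x in Metric.sphere (0 : EuclideanSpace ℝ (Fin d)) 1,
        (∑ j, ζ₁ j * (x j : ℂ)) ^ k * (∑ j, ζ₂ j * (x j : ℂ)) ^ k ∂(μH[(d : ℝ) - 1]))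
    (k : ℕ) (hk : 1 ≤ k) :
    I k = (∑ j, ζ₁ j * ζ₂ j) * ((k : ℂ) / (2 * k + d - 2)) * I (k - 1) := by
  obtain ⟨m, rfl⟩ := Nat.exists_eq_add_of_le' hk
  have hfin : μH[(d : ℝ) - 1] (Metric.sphere (0 : EuclideanSpace ℝ (Fin d)) 1) < ⊤ := by
    obtain ⟨n, rfl⟩ := Nat.exists_eq_add_of_le' (by lia : 1 ≤ d)
    simpa using hausdorffMeasure_sphere_lt_top n
  have hint {h : EuclideanSpace ℝ (Fin d) → ℂ} (hh : Continuous h) :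
      IntegrableOn h (Metric.sphere 0 1) μH[(d : ℝ) - 1] :=
    hh.continuousOn.integrableOn_of_subset_isCompact
      (isCompact_sphere 0 1) Metric.isClosed_sphere.measurableSet subset_rfl hfin.ne
  let ℓ : (Fin d → ℂ) → EuclideanSpace ℝ (Fin d) →L[ℝ] ℂ := fun ζ =>
    ∑ j, ζ j • Complex.ofRealCLM.comp (EuclideanSpace.proj j)
  have hℓ (ζ x) : ℓ ζ x = ∑ j, ζ j * (x j : ℂ) := by simp [ℓ]
  have hℓe (ζ i) : ℓ ζ (EuclideanSpace.single i 1) = ζ i := by simp [hℓ, apply_ite]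
  let g : EuclideanSpace ℝ (Fin d) → ℂ := fun x => ℓ ζ₁ x ^ m * ℓ ζ₂ x ^ (m + 1)
  have hg : ContDiff ℝ 1 g := ((ℓ ζ₁).contDiff.pow m).mul ((ℓ ζ₂).contDiff.pow (m + 1))
  have hg' (x v) : fderiv ℝ g x v = m * ℓ ζ₁ x ^ (m - 1) * ℓ ζ₁ v * ℓ ζ₂ x ^ (m + 1) +
      ℓ ζ₁ x ^ m * ((m + 1) * ℓ ζ₂ x ^ m * ℓ ζ₂ v) := by
    have := ((ℓ ζ₁).hasFDerivAt (x := x).pow m).fun_mul ((ℓ ζ₂).hasFDerivAt (x := x).pow (m + 1))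
    rw [this.fderiv]
    simp
    ring
  have hEuler (x) : fderiv ℝ g x x = (2 * m + 1) * g x := by
    rw [hg']
    rcases m with _ | m
    · simp [g]
    · simp [g]
      ring
  have hsum := Finset.sum_congr rfl fun i (_ : i ∈ Finset.univ) =>
    congrArg (ζ₁ i * ·) (integral_sphere_fderiv_single hfin hg i)
  simp only [← integral_const_mul, hEuler] at hsum
  rw [← integral_finsetSum, ← integral_finsetSum] at hsum
  · have hl : ∀ x, ∑ i, ζ₁ i * fderiv ℝ g x (EuclideanSpace.single i 1) =
        ((m + 1) * ∑ j, ζ₁ j * ζ₂ j) * (ℓ ζ₁ x ^ m * ℓ ζ₂ x ^ m) := fun x => by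
      calc _ = (m * ℓ ζ₁ x ^ (m - 1) * ℓ ζ₂ x ^ (m + 1)) * (∑ j, ζ₁ j * ζ₁ j) +
            ((m + 1) * ∑ j, ζ₁ j * ζ₂ j) * (ℓ ζ₁ x ^ m * ℓ ζ₂ x ^ m) := by
            simp only [hg', hℓe, Finset.mul_sum, Finset.sum_mul, ← Finset.sum_add_distrib]
            exact Finset.sum_congr rfl fun i _ => by ring
        _ = _ := by rw [h₁]; ring
    have hr : ∀ x : EuclideanSpace ℝ (Fin d),
        ∑ i, ζ₁ i * ((x i : ℂ) * ((d - 1) * g x + (2 * m + 1) * g x)) =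
        (2 * m + d) * (ℓ ζ₁ x ^ (m + 1) * ℓ ζ₂ x ^ (m + 1)) := fun x => by
      simp only [← mul_assoc, ← Finset.sum_mul, ← hℓ, g]
      ring
    simp only [hl, hr, integral_const_mul, hℓ, ← hI] at hsum
    have hne : (2 * m + d : ℂ) ≠ 0 := by exact_mod_cast (by lia : 2 * m + d ≠ 0)
    have hne' : 2 * ((m + 1 : ℕ) : ℂ) + d - 2 = 2 * m + d := by push_cast; ring
    rw [hne', Nat.add_sub_cancel]
    field_simp
    push_cast
    linear_combination -hsum
  · exact fun i _ => hint (by have := hg.continuous; fun_prop)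
  · exact fun i _ => hint (continuous_const.mul
      ((hg.continuous_fderiv one_ne_zero).clm_apply continuous_const))
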